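/- Every xor-set XS ⊆ ℤ₂^ω is a maximal thin set; in particular, XS is not a Borel subset of the Cantor cube. -/

import Mathlib

/-- The Cantor cube `ℤ₂^ω`, modeled as infinite binary sequences. -/
abbrev Cantor := ℕ → Bool

/-- The (possibly infinite) Hamming distance between two infinite binary sequences. -/
noncomputable def hd (x y : Cantor) : ℕ∞ := {n : ℕ | x n ≠ y n}.encard

/-- The relation `x ∼ y` iff `hd x y < ∞`. -/
def simRel (x y : Cantor) : Prop := hd x y < ⊤

/-- The `∼`-equivalence class of `x`. -/
def simClass (x : Cantor) : Set Cantor := {y | simRel x y}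

/-- The relation `x ≈ y` iff `hd x y` is finite and even. -/
def apRel (x y : Cantor) : Prop := ∃ m : ℕ, Even m ∧ hd x y = (m : ℕ∞)

/-- The `≈`-equivalence class of `x`. -/
def apClass (x : Cantor) : Set Cantor := {y | apRel x y}

/-- `x^{#n}`: the sequence `x` with the `n`-th bit flipped. -/
def flipAt (x : Cantor) (n : ℕ) : Cantor := fun k => if k = n then !x k else x k

/-- `XS` is a xor-set if for every `n` and `x`: `x ∈ XS ↔ x^{#n} ∉ XS`. -/
def IsXorSet (XS : Set Cantor) : Prop := ∀ (n : ℕ) (x : Cantor), x ∈ XS ↔ flipAt x n ∉ XS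

open MeasureTheory

/-- `T` is thin: `hd x y ≥ 2` for all distinct `x, y ∈ T`. -/
def IsThin (T : Set Cantor) : Prop := ∀ x ∈ T, ∀ y ∈ T, x ≠ y → 2 ≤ hd x y

theorem flipAt_flipAt (x : Cantor) (n : ℕ) : flipAt (flipAt x n) n = x := by
  funext k
  by_cases hk : k = n <;> simp [flipAt, hk]

theorem continuous_flipAt (n : ℕ) : Continuous fun x : Cantor => flipAt x n := by
  refine continuous_pi fun k => ?_
  by_cases hk : k = n
  · simpa [flipAt, hk, Function.comp_def] using (continuous_of_discreteTopology (f := Bool.not)).comp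
      (continuous_apply (A := fun _ : ℕ => Bool) n)
  · simpa [flipAt, hk] using continuous_apply (A := fun _ : ℕ => Bool) k

/-- Flipping the `n`-th bit, as a homeomorphism of the Cantor cube. -/
def flipHomeomorph (n : ℕ) : Cantor ≃ₜ Cantor where
  toFun x := flipAt x n
  invFun x := flipAt x n
  left_inv x := flipAt_flipAt x n
  right_inv x := flipAt_flipAt x n
  continuous_toFun := continuous_flipAt n
  continuous_invFun := continuous_flipAt n

theorem tendsto_flipAt_residual (n : ℕ) :
    Filter.Tendsto (fun x => flipAt x n) (residual Cantor) (residual Cantor) :=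
  tendsto_residual_of_isOpenMap (flipHomeomorph n).continuous (flipHomeomorph n).isOpenMap

theorem tendsto_flipAt_atTop (x : Cantor) :
    Filter.Tendsto (flipAt x) Filter.atTop (nhds x) := by
  refine tendsto_pi_nhds.2 fun k => tendsto_const_nhds.congr' ?_
  filter_upwards [Filter.eventually_gt_atTop k] with n hn
  simp [flipAt, hn.ne]

theorem setOf_ne_flipAt (x : Cantor) (n : ℕ) : {k | x k ≠ flipAt x n k} = {n} := by
  ext k
  by_cases hk : k = n <;> simp [flipAt, hk]

theorem hd_flipAt (x : Cantor) (n : ℕ) : hd x (flipAt x n) = 1 := by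
  rw [hd, setOf_ne_flipAt, Set.encard_singleton]

theorem ne_flipAt (x : Cantor) (n : ℕ) : x ≠ flipAt x n := by
  intro h
  simpa [flipAt] using congrFun h n

/-- Sequences at Hamming distance one differ by a single flip. -/
theorem exists_eq_flipAt_of_hd_eq_one {x y : Cantor} (h : hd x y = 1) : ∃ n, y = flipAt x n := by
  obtain ⟨n, hn⟩ := Set.encard_eq_one.1 h
  refine ⟨n, funext fun k => ?_⟩
  have hk : x k ≠ y k ↔ k = n := by simpa using Set.ext_iff.1 hn k
  by_cases hkn : k = n
  · have := hk.2 hkn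
    simp only [flipAt, if_pos hkn]
    cases hx : x k <;> cases hy : y k <;> simp_all
  · simpa [flipAt, hkn, eq_comm] using hk.not.2 hkn

theorem IsThin.flipAt_notMem {T : Set Cantor} (hT : IsThin T) {x : Cantor} (hx : x ∈ T) (n : ℕ) :
    flipAt x n ∉ T := by
  intro hy
  have h := hT x hx _ hy (ne_flipAt x n)
  rw [hd_flipAt] at h
  exact absurd h (by decide)

theorem IsXorSet.isThin {XS : Set Cantor} (hXS : IsXorSet XS) : IsThin XS := by
  intro x hx y hy hne
  by_contra hlt
  have hle : hd x y ≤ 1 := ENat.lt_two_iff.1 (not_le.1 hlt)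
  have hpos : 1 ≤ hd x y := by
    rw [hd, Set.one_le_encard_iff_nonempty]
    exact Function.ne_iff.1 hne
  obtain ⟨n, rfl⟩ := exists_eq_flipAt_of_hd_eq_one (le_antisymm hle hpos)
  exact (hXS n x).1 hx hy

theorem IsXorSet.eq_of_subset_isThin {XS S : Set Cantor} (hXS : IsXorSet XS) (hS : IsThin S)
    (h : XS ⊆ S) : S = XS := by
  refine Set.Subset.antisymm (fun x hx => ?_) h
  exact (hXS 0 x).2 fun hf => hS.flipAt_notMem hx 0 (h hf)

/-- A xor-set does not have the Baire property. -/
theorem IsXorSet.not_baireMeasurableSet {XS : Set Cantor} (hXS : IsXorSet XS) :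
    ¬ BaireMeasurableSet XS := by
  intro hB
  obtain ⟨U, hU, hXU⟩ := hB.residualEq_isOpen
  have hmem : ∀ᶠ x in residual Cantor, x ∈ XS ↔ x ∈ U := Filter.eventuallyEq_set.1 hXU
  have hdense (n : ℕ) : Dense {x : Cantor | x ∈ U ↔ flipAt x n ∉ U} := by
    apply dense_of_mem_residual
    filter_upwards [hmem, (tendsto_flipAt_residual n).eventually hmem] with x h₁ h₂
    exact h₁.symm.trans ((hXS n x).trans h₂.not)
  rcases U.eq_empty_or_nonempty with rfl | ⟨x, hx⟩
  · obtain ⟨y, hy⟩ := (hdense 0).nonempty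
    simp at hy
  · obtain ⟨n, hn⟩ := ((tendsto_flipAt_atTop x).eventually (hU.mem_nhds hx)).exists
    obtain ⟨y, ⟨hyU, hfU⟩, hy⟩ := (hdense n).inter_open_nonempty _
      (hU.inter (hU.preimage (continuous_flipAt n))) ⟨x, hx, hn⟩
    exact hy.1 hyU hfU

/-- Every xor-set is a maximal thin set; in particular it is not Borel. -/
theorem xorSet_maximal_thin_not_borel (XS : Set Cantor) (hXS : IsXorSet XS) :
    (IsThin XS ∧ ∀ S : Set Cantor, IsThin S → XS ⊆ S → S = XS) ∧
    ¬ MeasurableSet[borel Cantor] XS := by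
  refine ⟨⟨hXS.isThin, fun S hS h => hXS.eq_of_subset_isThin hS h⟩, fun hm => ?_⟩
  borelize Cantor
  exact hXS.not_baireMeasurableSet hm.baireMeasurableSet
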